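/- Generic freeness: let R be a commutative Noetherian integral domain, let A be a finitely generated R-algebra, and let M be a finitely generated A-module. Then there exists a nonzero element f ∈ R such that the localization M_f is a free module over R_f. -/

import Mathlib

theorem gf_filtration {S N M : Type*} [CommRing S] [AddCommGroup N] [AddCommGroup M] [Module S N]
    [Module S M] (g : ℕ → N →ₗ[S] M) (F : ℕ → Submodule S M) (h0 : F 0 = ⊥)
    (hs : ∀ i, F (i + 1) = F i ⊔ LinearMap.range (g i)) (ht : ⨆ i, F i = ⊤)
    (hfree : ∀ i, Module.Free S (N ⧸ (F i).comap (g i))) : Module.Free S M := by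
  classical
  have hsec : ∀ i, ∃ σ : (N ⧸ (F i).comap (g i)) →ₗ[S] N,
      ((F i).comap (g i)).mkQ.comp σ = LinearMap.id := fun i =>
    Module.projective_lifting_property _ _ (Submodule.mkQ_surjective _)
  choose σ hσ using hsec
  have hσ' : ∀ i q, Submodule.Quotient.mk (σ i q) = q := fun i q => LinearMap.congr_fun (hσ i) q
  let h : ∀ i, (N ⧸ (F i).comap (g i)) →ₗ[S] M := fun i => (g i).comp (σ i)
  have hmem : ∀ i q, h i q ∈ F i → q = 0 := by
    intro i q hq
    rw [← hσ' i q, Submodule.Quotient.mk_eq_zero]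
    exact hq
  have hmono : Monotone F := monotone_nat_of_le_succ fun i => by rw [hs]; exact le_sup_left
  have hin : ∀ i q, h i q ∈ F (i + 1) := fun i q => by
    rw [hs]; exact Submodule.mem_sup_right ⟨_, rfl⟩
  let φ := DFinsupp.lsum ℕ h
  have hφ : ∀ i q, φ (DFinsupp.single i q) = h i q := fun i q => by simp [φ]
  have hsurj : Function.Surjective φ := by
    rw [← LinearMap.range_eq_top, ← top_le_iff, ← ht, iSup_le_iff]
    intro i
    induction i with
    | zero => simp [h0]
    | succ i ih =>
      rw [hs, sup_le_iff]
      refine ⟨ih, ?_⟩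
      rintro _ ⟨n, rfl⟩
      have h1 : n - σ i (Submodule.Quotient.mk n) ∈ (F i).comap (g i) := by
        rw [← Submodule.Quotient.eq, hσ']
      have h2 := ih h1
      rw [map_sub] at h2
      have h3 : g i (σ i (Submodule.Quotient.mk n)) ∈ LinearMap.range φ := ⟨_, hφ i _⟩
      simpa using add_mem h2 h3
  have hinj : Function.Injective φ := by
    rw [← LinearMap.ker_eq_bot, eq_bot_iff]
    intro x hx
    rw [LinearMap.mem_ker] at hx
    rw [Submodule.mem_bot]
    by_contra hne
    have hsup : x.support.Nonempty := by
      rwa [Finset.nonempty_iff_ne_empty, Ne, DFinsupp.support_eq_empty]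
    set m := x.support.max' hsup with hm
    have hmm : m ∈ x.support := Finset.max'_mem _ _
    have hsum : φ x = ∑ i ∈ x.support, h i (x i) := by
      conv_lhs => rw [← DFinsupp.sum_single (f := x)]
      rw [DFinsupp.sum, map_sum]
      exact Finset.sum_congr rfl fun i _ => hφ i _
    rw [hsum, ← Finset.add_sum_erase _ _ hmm] at hx
    apply DFinsupp.mem_support_iff.mp hmm
    apply hmem
    rw [eq_neg_of_add_eq_zero_left hx]
    refine neg_mem (sum_mem fun i hi => ?_)
    have : i < m := lt_of_le_of_ne (Finset.le_max' _ _ (Finset.mem_of_mem_erase hi))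
      (Finset.ne_of_mem_erase hi)
    exact hmono this (hin i _)
  exact Module.Free.of_equiv (LinearEquiv.ofBijective φ ⟨hinj, hsurj⟩)

theorem gf_localized {R N M : Type*} [CommRing R] [AddCommGroup N] [AddCommGroup M] [Module R N]
    [Module R M] (f : R) (g : ℕ → N →ₗ[R] M) (F : ℕ → Submodule R M) (h0 : F 0 = ⊥)
    (hs : ∀ i, F (i + 1) = F i ⊔ LinearMap.range (g i)) (ht : ⨆ i, F i = ⊤)
    (hfree : ∀ i, Module.Free (Localization.Away f)
      (LocalizedModule (Submonoid.powers f) (N ⧸ (F i).comap (g i)))) :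
    Module.Free (Localization.Away f) (LocalizedModule (Submonoid.powers f) M) := by
  set p := Submonoid.powers f
  refine gf_filtration (S := Localization p) (fun i => LocalizedModule.map p (g i))
    (fun i => (F i).localized p) ?_ ?_ ?_ ?_
  · simp [h0]
  · intro i
    rw [hs, Submodule.localized, (Submodule.localized'gi (Localization p) p
      (LocalizedModule.mkLinearMap p M)).gc.l_sup, LinearMap.localized'_range_eq_range_localizedMap
      (Localization p) p (LocalizedModule.mkLinearMap p N)]
    rfl
  · rw [← Submodule.localized'_iSup, ht, Submodule.localized'_top]
  · intro i
    have : ((F i).localized p).comap (LocalizedModule.map p (g i)) =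
        ((F i).comap (g i)).localized p := by
      ext x
      obtain ⟨⟨n, s⟩, rfl⟩ := IsLocalizedModule.mk'_surjective p (LocalizedModule.mkLinearMap p N) x
      simp only [Submodule.mem_comap, Submodule.mem_localized', Function.uncurry_apply_pair]
      rw [LocalizedModule.map, IsLocalizedModule.mapExtendScalars_apply_apply]
      rw [IsLocalizedModule.map_mk']
      constructor
      · rintro ⟨m, hm, t, h⟩
        rw [IsLocalizedModule.mk'_eq_mk'_iff] at h
        obtain ⟨u, hu⟩ := h
        refine ⟨(u * t) • n, ?_, u * t * s, ?_⟩
        · have : g i ((u * t) • n) = (u * s) • m := by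
            rw [Submonoid.smul_def, map_smul, ← Submonoid.smul_def, mul_smul, mul_smul, hu]
          rw [this]
          exact Submodule.smul_of_tower_mem _ _ hm
        · simp
      · rintro ⟨m, hm, t, h⟩
        refine ⟨g i m, hm, t, ?_⟩
        rw [← IsLocalizedModule.map_mk' p (LocalizedModule.mkLinearMap p N), h, IsLocalizedModule.map_mk']
    rw [this]
    exact Module.Free.of_equiv (localizedQuotientEquiv p ((F i).comap (g i))).symm

theorem gf_transfer {R Q Q' : Type*} [CommRing R] [AddCommGroup Q] [Module R Q]
    [AddCommGroup Q'] [Module R Q'] (e : Q ≃ₗ[R] Q')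
    (f g : R) (hfg : f ∣ g)
    (h : Module.Free (Localization.Away f) (LocalizedModule (Submonoid.powers f) Q)) :
    Module.Free (Localization.Away g) (LocalizedModule (Submonoid.powers g) Q') := by
  have hu : IsUnit (algebraMap R (Localization.Away g) f) :=
    isUnit_of_dvd_unit ((algebraMap R (Localization.Away g)).map_dvd hfg)
      (IsLocalization.Away.algebraMap_isUnit g)
  let _ : Algebra (Localization.Away f) (Localization.Away g) :=
    (IsLocalization.Away.lift f hu).toAlgebra
  have : IsScalarTower R (Localization.Away f) (Localization.Away g) :=
    IsScalarTower.of_algebraMap_eq fun x => (IsLocalization.Away.lift_eq f hu x).symm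
  let L := LocalizedModule (Submonoid.powers g) Q'
  let L' := TensorProduct (Localization.Away f) (Localization.Away g)
    (LocalizedModule (Submonoid.powers f) Q)
  have : Module.Free (Localization.Away g) L' := inferInstance
  have h1 : IsBaseChange (Localization.Away f) (LocalizedModule.mkLinearMap (Submonoid.powers f) Q) :=
    (isLocalizedModule_iff_isBaseChange (Submonoid.powers f) _ _).mp inferInstance
  have h2 : IsBaseChange (Localization.Away g) (LocalizedModule.mkLinearMap (Submonoid.powers g) Q') :=
    (isLocalizedModule_iff_isBaseChange (Submonoid.powers g) _ _).mp inferInstance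
  have h3 := TensorProduct.isBaseChange (Localization.Away f)
    (LocalizedModule (Submonoid.powers f) Q) (Localization.Away g)
  have h4 := h1.comp h3
  exact Module.Free.of_equiv (h4.equiv.symm ≪≫ₗ (e.baseChange R (Localization.Away g) _ _) ≪≫ₗ h2.equiv)

/-- Generic freeness for all finite modules over a fixed algebra. -/
def GFAlg.{v} (R B : Type*) [CommRing R] [CommRing B] [Algebra R B] : Prop :=
  ∀ (N : Type v) [AddCommGroup N] [Module B N] [Module R N] [IsScalarTower R B N]
    [Module.Finite B N], ∃ f : R, f ≠ 0 ∧
      Module.Free (Localization.Away f) (LocalizedModule (Submonoid.powers f) N)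

theorem gf_base.{v} (R : Type*) [CommRing R] [IsDomain R] [IsNoetherianRing R] :
    GFAlg.{v} R R := by
  intro N _ i1 i2 tower fin
  have heq : i1 = i2 := Module.ext' i1 i2 fun r n => by
    have h1 := tower.smul_assoc r 1 n
    rw [smul_eq_mul, mul_one, @one_smul R N _ i1.toMulAction] at h1
    exact h1
  subst heq
  have : Module.FinitePresentation R N := Module.finitePresentation_of_finite R N
  have : Module.Free (FractionRing R) (LocalizedModule (nonZeroDivisors R) N) :=
    inferInstance
  obtain ⟨r, hr, h, -⟩ := Module.FinitePresentation.exists_free_localizedModule_powers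
    (nonZeroDivisors R) (LocalizedModule.mkLinearMap (nonZeroDivisors R) N) (FractionRing R)
  exact ⟨r, nonZeroDivisors.ne_zero hr, h⟩

theorem gf_surj.{v} {R B C : Type*} [CommRing R] [CommRing B] [Algebra R B] [CommRing C]
    [Algebra R C] (φ : B →ₐ[R] C) (hφ : Function.Surjective φ) (h : GFAlg.{v} R B) :
    GFAlg.{v} R C := by
  intro N _ _ _ _ _
  let _ : Algebra B C := φ.toRingHom.toAlgebra
  let _ : Module B N := Module.compHom N φ.toRingHom
  have : IsScalarTower B C N := ⟨fun b c n => mul_smul (φ b) c n⟩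
  have : IsScalarTower R B N := ⟨fun r b n => by
    change φ (r • b) • n = r • (φ b • n)
    rw [map_smul, smul_assoc]⟩
  have : Module.Finite B C := Module.Finite.of_surjective (Algebra.linearMap B C) hφ
  have : Module.Finite B N := Module.Finite.trans C N
  exact h N

open Polynomial in
theorem gf_poly.{v} {R B : Type*} [CommRing R] [IsDomain R] [CommRing B] [Algebra R B]
    [IsNoetherianRing B] (h : GFAlg.{v} R B) : GFAlg.{v} R B[X] := by
  intro M _ _ _ _ hfin
  let _ : Module B M := Module.compHom M (C : B →+* B[X])
  have : IsScalarTower B B[X] M := ⟨fun b c n => by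
    change (b • c) • n = C b • (c • n)
    rw [← mul_smul, smul_eq_C_mul]⟩
  have : IsScalarTower R B M := ⟨fun r b n => by
    change C (r • b) • n = r • (C b • n)
    rw [← smul_C, smul_assoc]⟩
  obtain ⟨s, hs⟩ := hfin.fg_top
  let N : Submodule B M := Submodule.span B (s : Set M)
  have hNfin : Module.Finite B N := Module.Finite.span_finset B s
  let mulX : M →ₗ[B] M := Module.toModuleEnd B (S := B[X]) M X
  have hmulX : ∀ m, mulX m = (X : B[X]) • m := fun m => rfl
  let g : ℕ → N →ₗ[B] M := fun i => (mulX ^ i).comp N.subtype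
  have hg : ∀ i n, mulX (g i n) = g (i + 1) n := fun i n => by
    simp only [g, LinearMap.comp_apply, pow_succ', Module.End.mul_apply]
  let F : ℕ → Submodule B M := fun i => Nat.rec ⊥ (fun i P => P ⊔ LinearMap.range (g i)) i
  have hF0 : F 0 = ⊥ := rfl
  have hFs : ∀ i, F (i + 1) = F i ⊔ LinearMap.range (g i) := fun i => rfl
  have hFX : ∀ i, F i ≤ (F (i + 1)).comap mulX := by
    intro i
    induction i with
    | zero => simp [hF0]
    | succ i ih =>
      rw [hFs i, sup_le_iff]
      constructor
      · refine ih.trans (Submodule.comap_mono ?_)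
        rw [hFs (i + 1)]; exact le_sup_left
      · rintro _ ⟨n, rfl⟩
        rw [Submodule.mem_comap, hg, hFs (i + 1)]
        exact Submodule.mem_sup_right ⟨n, rfl⟩
  have htop : ⨆ i, F i = ⊤ := by
    have hX : ∀ m ∈ ⨆ i, F i, (X : B[X]) • m ∈ ⨆ i, F i := by
      intro m hm
      have : (⨆ i, F i) ≤ (⨆ i, F i).comap mulX := iSup_le fun i =>
        (hFX i).trans (Submodule.comap_mono (le_iSup F (i + 1)))
      exact this hm
    have hall : ∀ (p : B[X]), ∀ m ∈ ⨆ i, F i, p • m ∈ ⨆ i, F i := by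
      intro p
      induction p using Polynomial.induction_on' with
      | add p q hp hq => intro m hm; rw [add_smul]; exact add_mem (hp m hm) (hq m hm)
      | monomial n b =>
        intro m hm
        rw [← C_mul_X_pow_eq_monomial, mul_smul]
        refine Submodule.smul_mem (⨆ i, F i) b ?_
        induction n with
        | zero => simpa using hm
        | succ n ih => rw [pow_succ', mul_smul]; exact hX _ ih
    let T : Submodule B[X] M := { (⨆ i, F i) with smul_mem' := fun p m hm => hall p m hm }
    have hT : T = ⊤ := by
      rw [← top_le_iff, ← hs, Submodule.span_le]
      intro x hx
      have h1 : x ∈ F 1 := by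
        change x ∈ F 0 ⊔ LinearMap.range (g 0)
        exact Submodule.mem_sup_right ⟨⟨x, Submodule.subset_span hx⟩, by simp [g]⟩
      exact (le_iSup F 1) h1
    rw [eq_top_iff]
    intro x _
    have : x ∈ T := hT ▸ Submodule.mem_top
    exact this
  let K : ℕ →o Submodule B N := ⟨fun i => (F i).comap (g i), monotone_nat_of_le_succ fun i n hn => by
    rw [Submodule.mem_comap, ← hg]
    exact hFX i hn⟩
  have : IsNoetherian B N := isNoetherian_of_isNoetherianRing_of_finite B N
  obtain ⟨n, hn⟩ := monotone_stabilizes_iff_noetherian.mpr this K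
  have hex : ∀ i, ∃ f : R, f ≠ 0 ∧ Module.Free (Localization.Away f)
      (LocalizedModule (Submonoid.powers f) (N ⧸ K i)) := fun i => h (N ⧸ K i)
  choose f hf0 hf using hex
  have hdvd : ∀ i, i ≤ n → f i ∣ ∏ j ∈ Finset.range (n + 1), f j := fun i hi =>
    Finset.dvd_prod_of_mem f (Finset.mem_range.mpr (Nat.lt_succ_of_le hi))
  refine ⟨∏ j ∈ Finset.range (n + 1), f j, Finset.prod_ne_zero_iff.mpr fun i _ => hf0 i, ?_⟩
  refine gf_localized _ (fun i => (g i).restrictScalars R) (fun i => (F i).restrictScalars R)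
    ?_ ?_ ?_ ?_
  · simp [hF0]
  · intro i
    change (F (i + 1)).restrictScalars R = _
    rw [hFs, Submodule.restrictScalars_sup]
    rfl
  · rw [← Submodule.restrictScalars_iSup, htop, Submodule.restrictScalars_top]
  · intro i
    have hi : ∃ j ≤ n, K j = K i := by
      rcases le_total i n with hin | hin
      · exact ⟨i, hin, rfl⟩
      · exact ⟨n, le_rfl, hn i hin⟩
    obtain ⟨j, hj, hji⟩ := hi
    exact gf_transfer ((Submodule.quotEquivOfEq _ _ hji).restrictScalars R ≪≫ₗ
      (Submodule.Quotient.restrictScalarsEquiv R (K i)).symm) _ _ (hdvd j hj) (hf j)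

theorem gf_mvPoly.{v} (R : Type*) [CommRing R] [IsDomain R] [IsNoetherianRing R] (n : ℕ) :
    GFAlg.{v} R (MvPolynomial (Fin n) R) := by
  induction n with
  | zero =>
    exact gf_surj (MvPolynomial.isEmptyAlgEquiv R (Fin 0)).symm.toAlgHom
      (MvPolynomial.isEmptyAlgEquiv R (Fin 0)).symm.surjective (gf_base R)
  | succ n ih =>
    exact gf_surj (MvPolynomial.finSuccEquiv R n).symm.toAlgHom
      (MvPolynomial.finSuccEquiv R n).symm.surjective (gf_poly ih)

theorem generic_freeness
    {R : Type*} [CommRing R] [IsDomain R] [IsNoetherianRing R]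
    {A : Type*} [CommRing A] [Algebra R A] [Algebra.FiniteType R A]
    {M : Type*} [AddCommGroup M] [Module A M] [Module R M] [IsScalarTower R A M]
    [Module.Finite A M] :
    ∃ f : R, f ≠ 0 ∧
      Module.Free (Localization.Away f)
        (LocalizedModule (Submonoid.powers f) M) := by
  obtain ⟨n, φ, hφ⟩ := Algebra.FiniteType.iff_quotient_mvPolynomial''.mp
    (inferInstance : Algebra.FiniteType R A)
  exact gf_surj φ hφ (gf_mvPoly R n) M
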